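/- Let Ω be a locally compact Hausdorff space with countable base, G a quasi-metric kernel on Ω with quasi-metric constant κ, 0 < q < 1, and μ, σ locally finite Radon measures on Ω. Then every sub-solution u, i.e., a Borel function u ≥ 0 with u ≤ G(u^q dσ) + Gμ < +∞ σ-a.e., satisfies u(x) ≤ (8κ)^{q/(1−q)} [(Gσ(x))^{1/(1−q)} + Kσ(x) + Gμ(x)] at every x ∈ Ω such that u(x) ≤ G(u^q dσ)(x) + Gμ(x); in particular, this estimate holds σ-a.e. -/

import Mathlib

open MeasureTheory ENNReal Set

noncomputable section

namespace NPE

variable {Ω : Type*} [TopologicalSpace Ω] [MeasurableSpace Ω]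

/-- The potential `Gμ(x) = ∫_Ω G(x,y) dμ(y)`. -/
def pot (G : Ω → Ω → ℝ≥0∞) (μ : Measure Ω) (x : Ω) : ℝ≥0∞ :=
  ∫⁻ y, G x y ∂μ

/-- The potential `G(f dσ)(x) = ∫_Ω G(x,y) f(y) dσ(y)`. -/
def potF (G : Ω → Ω → ℝ≥0∞) (σ : Measure Ω) (f : Ω → ℝ≥0∞) (x : Ω) : ℝ≥0∞ :=
  ∫⁻ y, G x y * f y ∂σ

/-- A kernel on `Ω` is a lower semicontinuous function `Ω × Ω → [0,∞]`. -/
def IsKernel (G : Ω → Ω → ℝ≥0∞) : Prop :=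
  LowerSemicontinuous (fun p : Ω × Ω => G p.1 p.2)

/-- A quasi-metric kernel with quasi-metric constant `κ ≥ 1/2`: positive, symmetric and
`d := 1/G` satisfies the quasi-triangle inequality. -/
def IsQuasiMetricKernel (G : Ω → Ω → ℝ≥0∞) (κ : ℝ) : Prop :=
  IsKernel G ∧ (1 / 2 : ℝ) ≤ κ ∧ (∀ x y, 0 < G x y) ∧ (∀ x y, G x y = G y x) ∧
    ∀ x y z, (G x y)⁻¹ ≤ ENNReal.ofReal κ * ((G x z)⁻¹ + (G z y)⁻¹)

/-- The closed support of a measure. -/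
def msupp (μ : Measure Ω) : Set Ω :=
  {x | ∀ U : Set Ω, IsOpen U → x ∈ U → 0 < μ U}

/-- The weak maximum principle with constant `b ≥ 1`. -/
def WMP (G : Ω → Ω → ℝ≥0∞) (b : ℝ) : Prop :=
  1 ≤ b ∧ ∀ μ : Measure Ω, IsLocallyFiniteMeasure μ →
    (∀ x ∈ msupp μ, pot G μ x ≤ 1) → ∀ x, pot G μ x ≤ ENNReal.ofReal b

/-- Quasi-symmetry with constant `a ≥ 1`. -/
def QS (G : Ω → Ω → ℝ≥0∞) (a : ℝ) : Prop :=
  1 ≤ a ∧ ∀ x y, (ENNReal.ofReal a)⁻¹ * G y x ≤ G x y ∧ G x y ≤ ENNReal.ofReal a * G y x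

/-- The `L^q` quasi-norm of a nonnegative function with respect to `σ`. -/
def lqNorm (q : ℝ) (σ : Measure Ω) (f : Ω → ℝ≥0∞) : ℝ≥0∞ :=
  (∫⁻ x, f x ^ q ∂σ) ^ (1 / q)

/-- The least constant `ϰ` in the `(1,q)` weighted norm inequality
`‖Gν‖_{L^q(σ)} ≤ C ‖ν‖` over all finite Radon measures `ν`. -/
def kappa (G : Ω → Ω → ℝ≥0∞) (q : ℝ) (σ : Measure Ω) : ℝ≥0∞ :=
  sInf {C : ℝ≥0∞ | ∀ ν : Measure Ω, IsFiniteMeasure ν →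
    lqNorm q σ (pot G ν) ≤ C * ν Set.univ}

/-- The ball `B(x,r) = {y : G(x,y) > 1/r}`, i.e. `{y : d(x,y) < r}` with `d = 1/G`. -/
def ball (G : Ω → Ω → ℝ≥0∞) (x : Ω) (r : ℝ) : Set Ω :=
  {y | (G x y)⁻¹ < ENNReal.ofReal r}

/-- The intrinsic nonlinear potential
`Kσ(x) = ∫_0^∞ ϰ(B(x,r))^{q/(1-q)} r⁻² dr`. -/
def kpot (G : Ω → Ω → ℝ≥0∞) (q : ℝ) (σ : Measure Ω) (x : Ω) : ℝ≥0∞ :=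
  ∫⁻ r in Set.Ioi (0 : ℝ),
    kappa G q (σ.restrict (ball G x r)) ^ (q / (1 - q)) / ENNReal.ofReal (r ^ 2)

/-- A nontrivial super-solution of `u = G(u^q dσ) + d`:
`u > 0` σ-a.e. and `G(u^q dσ) + d ≤ u < ∞` σ-a.e. -/
def IsSupSol (G : Ω → Ω → ℝ≥0∞) (σ : Measure Ω) (q : ℝ) (d : Ω → ℝ≥0∞)
    (u : Ω → ℝ≥0∞) : Prop :=
  Measurable u ∧ (∀ᵐ x ∂σ, 0 < u x) ∧
    ∀ᵐ x ∂σ, potF G σ (fun y => u y ^ q) x + d x ≤ u x ∧ u x < ∞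

/-- A sub-solution: `u ≤ G(u^q dσ) + d < ∞` σ-a.e. -/
def IsSubSol (G : Ω → Ω → ℝ≥0∞) (σ : Measure Ω) (q : ℝ) (d : Ω → ℝ≥0∞)
    (u : Ω → ℝ≥0∞) : Prop :=
  Measurable u ∧
    ∀ᵐ x ∂σ, u x ≤ potF G σ (fun y => u y ^ q) x + d x ∧
      potF G σ (fun y => u y ^ q) x + d x < ∞

/-- A nontrivial solution: `u > 0` σ-a.e. and `u = G(u^q dσ) + d`, `u < ∞`, σ-a.e. -/
def IsSol (G : Ω → Ω → ℝ≥0∞) (σ : Measure Ω) (q : ℝ) (d : Ω → ℝ≥0∞)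
    (u : Ω → ℝ≥0∞) : Prop :=
  Measurable u ∧ (∀ᵐ x ∂σ, 0 < u x) ∧
    ∀ᵐ x ∂σ, u x = potF G σ (fun y => u y ^ q) x + d x ∧ u x < ∞

/-- The growth conditions `∫_a^∞ σ(B(x₀,r)) r⁻² dr < ∞`,
`∫_a^∞ ϰ(B(x₀,r))^{q/(1-q)} r⁻² dr < ∞` and `∫_a^∞ μ(B(x₀,r)) r⁻² dr < ∞`. -/
def growthConds (G : Ω → Ω → ℝ≥0∞) (q : ℝ) (σ μ : Measure Ω) (x₀ : Ω) (a : ℝ) : Prop :=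
  (∫⁻ r in Set.Ioi a, σ (ball G x₀ r) / ENNReal.ofReal (r ^ 2)) < ∞ ∧
  (∫⁻ r in Set.Ioi a,
      kappa G q (σ.restrict (ball G x₀ r)) ^ (q / (1 - q)) / ENNReal.ofReal (r ^ 2)) < ∞ ∧
  (∫⁻ r in Set.Ioi a, μ (ball G x₀ r) / ENNReal.ofReal (r ^ 2)) < ∞

/-- The modified kernel `G̃(x,y) = G(x,y)/(m(x)m(y))`. -/
def modKer (G : Ω → Ω → ℝ≥0∞) (m : Ω → ℝ) : Ω → Ω → ℝ≥0∞ :=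
  fun x y => G x y / (ENNReal.ofReal (m x) * ENNReal.ofReal (m y))

/-- The modified measure `dσ̃ = m^{1+q} dσ`. -/
def modMeas (σ : Measure Ω) (m : Ω → ℝ) (q : ℝ) : Measure Ω :=
  σ.withDensity fun x => ENNReal.ofReal (m x) ^ ((1 : ℝ) + q)

set_option linter.unusedSectionVars false

lemma lint_inv_sq_pos {a : ℝ} (ha : 0 < a) :
    ∫⁻ r in Set.Ioi a, (ENNReal.ofReal (r ^ 2))⁻¹ = (ENNReal.ofReal a)⁻¹ := by
  have h1 := integral_Ioi_rpow_of_lt (a := -2) (by norm_num) ha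
  have h2 := integrableOn_Ioi_rpow_of_lt (a := -2) (by norm_num) ha
  have h3 := ofReal_integral_eq_lintegral_ofReal h2 (by
    filter_upwards [ae_restrict_mem measurableSet_Ioi] with t ht
    have : 0 < t := ha.trans ht
    simp only [Pi.zero_apply]; positivity)
  rw [h1] at h3
  have h4 : -a ^ ((-2 : ℝ) + 1) / (-2 + 1) = a⁻¹ := by
    rw [show (-2 : ℝ) + 1 = -1 by norm_num, Real.rpow_neg_one]; ring
  rw [h4, ENNReal.ofReal_inv_of_pos ha] at h3
  rw [h3]
  refine setLIntegral_congr_fun measurableSet_Ioi fun t ht => ?_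
  have ht0 : 0 < t := ha.trans ht
  rw [← ENNReal.ofReal_inv_of_pos (by positivity), Real.rpow_neg ht0.le]
  norm_cast

lemma lint_inv_sq {a : ℝ} (ha : 0 ≤ a) :
    ∫⁻ r in Set.Ioi a, (ENNReal.ofReal (r ^ 2))⁻¹ = (ENNReal.ofReal a)⁻¹ := by
  rcases ha.eq_or_lt with h | h
  · subst h
    simp only [ENNReal.ofReal_zero, ENNReal.inv_zero]
    refine ENNReal.eq_top_of_forall_nnreal_le fun t => ?_
    have ht : (0 : ℝ) < ((t : ℝ) + 1)⁻¹ := by positivity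
    calc (t : ℝ≥0∞) ≤ (ENNReal.ofReal (((t : ℝ) + 1)⁻¹))⁻¹ := by
          rw [ENNReal.ofReal_inv_of_pos (by positivity), inv_inv,
            ← ENNReal.ofReal_coe_nnreal]
          exact ENNReal.ofReal_le_ofReal (by linarith)
      _ = _ := (lint_inv_sq_pos ht).symm
      _ ≤ _ := lintegral_mono_set (Set.Ioi_subset_Ioi ht.le)
  · exact lint_inv_sq_pos h

lemma inner_int {d : ℝ≥0∞} (hd : d ≠ ∞) {c ε : ℝ} (hc : 0 < c) (hε : 0 ≤ ε) :
    ∫⁻ r in Set.Ioi ε, (if d < ENNReal.ofReal (c * r) then (ENNReal.ofReal (r ^ 2))⁻¹ else 0)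
      = (max (d / ENNReal.ofReal c) (ENNReal.ofReal ε))⁻¹ := by
  have h : ∀ r ∈ Set.Ioi ε,
      (if d < ENNReal.ofReal (c * r) then (ENNReal.ofReal (r ^ 2))⁻¹ else 0)
      = (Set.Ioi (d.toReal / c)).indicator (fun r => (ENNReal.ofReal (r ^ 2))⁻¹) r := by
    intro r _
    rw [Set.indicator_apply]
    congr 1
    rw [eq_iff_iff, ENNReal.lt_ofReal_iff_toReal_lt hd, Set.mem_Ioi, div_lt_iff₀ hc, mul_comm]
  rw [setLIntegral_congr_fun measurableSet_Ioi h, setLIntegral_indicator measurableSet_Ioi,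
    Set.Ioi_inter_Ioi, lint_inv_sq (le_max_of_le_right hε)]
  congr 1
  have hm : Monotone ENNReal.ofReal := fun _ _ h => ENNReal.ofReal_le_ofReal h
  rw [hm.map_max, ENNReal.ofReal_div_of_pos hc, ENNReal.ofReal_toReal hd]

section top
variable [SecondCountableTopology Ω] [BorelSpace Ω]

lemma meas_G {G : Ω → Ω → ℝ≥0∞} (hG : IsKernel G) :
    Measurable (fun p : Ω × Ω => G p.1 p.2) := LowerSemicontinuous.measurable hG

lemma meas_Gx {G : Ω → Ω → ℝ≥0∞} (hG : IsKernel G) (x : Ω) : Measurable (G x) :=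
  (meas_G hG).comp measurable_prodMk_left

lemma meas_ball {G : Ω → Ω → ℝ≥0∞} (hG : IsKernel G) (x : Ω) (r : ℝ) :
    MeasurableSet (ball G x r) :=
  measurableSet_lt (meas_Gx hG x).inv measurable_const

lemma layer {G : Ω → Ω → ℝ≥0∞} (hG : IsKernel G) (hpos : ∀ x y, 0 < G x y)
    (ν : Measure Ω) [SFinite ν] (x : Ω) {c ε : ℝ} (hc : 0 < c) (hε : 0 ≤ ε) :
    ∫⁻ r in Set.Ioi ε, ν (ball G x (c * r)) / ENNReal.ofReal (r ^ 2)
      = ∫⁻ z, (max ((G x z)⁻¹ / ENNReal.ofReal c) (ENNReal.ofReal ε))⁻¹ ∂ν := by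
  have h1 : ∀ r : ℝ, ν (ball G x (c * r)) / ENNReal.ofReal (r ^ 2) =
      ∫⁻ z, (if (G x z)⁻¹ < ENNReal.ofReal (c * r) then (ENNReal.ofReal (r ^ 2))⁻¹ else 0) ∂ν := by
    intro r
    rw [div_eq_mul_inv, mul_comm, ← lintegral_indicator_const (meas_ball hG x _)]
    refine lintegral_congr fun z => ?_
    classical
    rw [Set.indicator_apply]
    simp only [ball, Set.mem_ofPred_eq]
    congr
  simp_rw [h1]
  rw [lintegral_lintegral_swap]
  · refine lintegral_congr fun z => ?_
    exact inner_int (by simpa using (hpos x z).ne') hc hε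
  · refine Measurable.aemeasurable ?_
    have : Measurable fun p : ℝ × Ω => (ENNReal.ofReal (p.1 ^ 2))⁻¹ := by fun_prop
    refine Measurable.ite (measurableSet_lt ?_ ?_) this measurable_const
    · exact ((meas_Gx hG x).comp measurable_snd).inv
    · fun_prop

lemma layer0 {G : Ω → Ω → ℝ≥0∞} (hG : IsKernel G) (hpos : ∀ x y, 0 < G x y)
    (ν : Measure Ω) [SFinite ν] (x : Ω) :
    ∫⁻ r in Set.Ioi (0 : ℝ), ν (ball G x r) / ENNReal.ofReal (r ^ 2) = pot G ν x := by
  have := layer hG hpos ν x one_pos le_rfl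
  simpa [pot] using this

end top

lemma ball_mono (G : Ω → Ω → ℝ≥0∞) (x : Ω) : Monotone (ball G x) := fun _ _ h _ hy =>
  lt_of_lt_of_le hy (ENNReal.ofReal_le_ofReal h)

lemma kappa_mono (G : Ω → Ω → ℝ≥0∞) {q : ℝ} (hq : 0 < q) {σ τ : Measure Ω} (h : σ ≤ τ) :
    kappa G q σ ≤ kappa G q τ := by
  refine sInf_le_sInf fun C hC ν hν => (?_ : _ ≤ _).trans (hC ν hν)
  exact ENNReal.rpow_le_rpow (lintegral_mono' h le_rfl) (by positivity)

lemma kappa_spec (G : Ω → Ω → ℝ≥0∞) {q : ℝ} (hq : 0 < q) (σ : Measure Ω)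
    (ν : Measure Ω) [hν : IsFiniteMeasure ν] :
    ∫⁻ x, (pot G ν x) ^ q ∂σ ≤ (kappa G q σ) ^ q * (ν Set.univ) ^ q := by
  have key : lqNorm q σ (pot G ν) ≤ kappa G q σ * ν Set.univ := by
    unfold kappa
    rw [sInf_eq_iInf', ENNReal.iInf_mul']
    · exact le_iInf fun C => C.2 ν hν
    · intro h; exact absurd h (measure_ne_top _ _)
    · intro h
      refine ⟨⟨∞, fun ρ hρ => ?_⟩⟩
      by_cases h0 : ρ Set.univ = 0
      · rw [Measure.measure_univ_eq_zero] at h0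
        subst h0
        simp [lqNorm, pot, hq]
      · rw [ENNReal.top_mul h0]; exact le_top
  have := ENNReal.rpow_le_rpow key hq.le
  rw [ENNReal.mul_rpow_of_nonneg _ _ hq.le] at this
  refine le_trans (le_of_eq ?_) this
  rw [lqNorm, ← ENNReal.rpow_mul, one_div, inv_mul_cancel₀ hq.ne', ENNReal.rpow_one]

/-- The final algebra step. -/
lemma algebra_step {T K S m : ℝ≥0∞} {κ q : ℝ} (hq0 : 0 < q) (hq1 : q < 1) (hκ : 1 / 2 ≤ κ)
    (hT : T ≠ ∞)
    (h : T ≤ (ENNReal.ofReal (2 * κ) * T) ^ q * (K ^ (1 - q) + S) + m) :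
    T ≤ ENNReal.ofReal ((8 * κ) ^ (q / (1 - q))) * (S ^ ((1 : ℝ) / (1 - q)) + K + m) := by
  have hq : 0 < 1 - q := by linarith
  have hκ1 : (1 : ℝ≥0∞) ≤ ENNReal.ofReal (2 * κ) := by
    rw [← ENNReal.ofReal_one]; exact ENNReal.ofReal_le_ofReal (by linarith)
  by_cases hT0 : T = 0
  · simp [hT0]
  by_cases hm : T ≤ m
  · have h8 : (1 : ℝ≥0∞) ≤ ENNReal.ofReal ((8 * κ) ^ (q / (1 - q))) := by
      rw [← ENNReal.ofReal_one]
      exact ENNReal.ofReal_le_ofReal (Real.one_le_rpow (by linarith) (by positivity))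
    calc T ≤ 1 * m := by rwa [one_mul]
      _ ≤ _ := mul_le_mul' h8 le_add_self
  push Not at hm
  have hm1 : m ≤ (ENNReal.ofReal (2 * κ) * T) ^ q * m ^ (1 - q) := by
    calc m = m ^ q * m ^ (1 - q) := by
          rw [← ENNReal.rpow_add_of_nonneg _ _ hq0.le hq.le]; simp
      _ ≤ _ := by
          gcongr
          calc m ≤ 1 * T := by rw [one_mul]; exact hm.le
            _ ≤ _ := by gcongr
  have h2 : T ≤ T ^ q * (ENNReal.ofReal (2 * κ) ^ q * (K ^ (1 - q) + S + m ^ (1 - q))) := by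
    calc T ≤ _ := h
      _ ≤ (ENNReal.ofReal (2 * κ) * T) ^ q * (K ^ (1 - q) + S) +
          (ENNReal.ofReal (2 * κ) * T) ^ q * m ^ (1 - q) := by gcongr
      _ = _ := by rw [ENNReal.mul_rpow_of_nonneg _ _ hq0.le]; ring
  have h3 : T ^ (1 - q) ≤ ENNReal.ofReal (2 * κ) ^ q * (K ^ (1 - q) + S + m ^ (1 - q)) := by
    have e : T ^ q * T ^ (1 - q) = T := by
      rw [← ENNReal.rpow_add_of_nonneg _ _ hq0.le hq.le]; simp
    have hTq0 : T ^ q ≠ 0 := by simp [hT0, ENNReal.rpow_eq_zero_iff, hT]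
    have hTq1 : T ^ q ≠ ∞ := ENNReal.rpow_ne_top_of_nonneg hq0.le hT
    rw [← ENNReal.mul_le_mul_iff_right hTq0 hTq1, e]
    exact h2
  have hp : (1 : ℝ) ≤ 1 / (1 - q) := by rw [le_div_iff₀ hq]; linarith
  have hp1 : 1 / (1 - q) - 1 = q / (1 - q) := by field_simp; ring
  have hp0 : (0 : ℝ) ≤ 1 / (1 - q) := by positivity
  have hid : ∀ a : ℝ≥0∞, (a ^ (1 - q)) ^ (1 / (1 - q)) = a := fun a => by
    rw [← ENNReal.rpow_mul, mul_one_div_cancel hq.ne', ENNReal.rpow_one]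
  have h4 := ENNReal.rpow_le_rpow h3 hp0
  rw [hid, ENNReal.mul_rpow_of_nonneg _ _ hp0, ← ENNReal.rpow_mul, mul_one_div] at h4
  have h5 : (K ^ (1 - q) + S + m ^ (1 - q)) ^ (1 / (1 - q)) ≤
      2 ^ (q / (1 - q)) * (2 ^ (q / (1 - q)) * (S ^ (1 / (1 - q)) + K + m)) := by
    have one2 : (1 : ℝ≥0∞) ≤ 2 ^ (q / (1 - q)) :=
      ENNReal.one_le_rpow (by norm_num) (by positivity)
    have a1 := ENNReal.rpow_add_le_mul_rpow_add_rpow (K ^ (1 - q) + S) (m ^ (1 - q)) hp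
    have a2 := ENNReal.rpow_add_le_mul_rpow_add_rpow (K ^ (1 - q)) S hp
    rw [hid, hp1] at a1 a2
    refine a1.trans ?_
    gcongr
    calc _ ≤ 2 ^ (q / (1 - q)) * (K + S ^ (1 / (1 - q))) + 2 ^ (q / (1 - q)) * m := by
          gcongr
          calc m = 1 * m := (one_mul m).symm
            _ ≤ _ := by gcongr
      _ = _ := by ring
  refine h4.trans ?_
  have h6 : ENNReal.ofReal ((8 * κ) ^ (q / (1 - q))) =
      ENNReal.ofReal (2 * κ) ^ (q / (1 - q)) * 2 ^ (q / (1 - q)) * 2 ^ (q / (1 - q)) := by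
    have hr : 0 ≤ q / (1 - q) := by positivity
    rw [← ENNReal.ofReal_rpow_of_pos (by linarith), ← ENNReal.mul_rpow_of_nonneg _ _ hr,
      ← ENNReal.mul_rpow_of_nonneg _ _ hr]
    congr 1
    rw [show (2 : ℝ≥0∞) = ENNReal.ofReal 2 by simp, ← ENNReal.ofReal_mul (by linarith),
      ← ENNReal.ofReal_mul (by linarith)]
    congr 1; ring
  rw [h6, mul_assoc, mul_assoc]
  gcongr

lemma inv_le_mul_inv' {b c k : ℝ≥0∞} (h0 : k ≠ 0) (h1 : k ≠ ∞) (h : c ≤ k * b) :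
    b⁻¹ ≤ k * c⁻¹ := by
  calc b⁻¹ = k * (k * b)⁻¹ := by
        rw [ENNReal.mul_inv (Or.inl h0) (Or.inl h1), ← mul_assoc, ENNReal.mul_inv_cancel h0 h1,
          one_mul]
    _ ≤ k * c⁻¹ := by gcongr

section top
variable [SecondCountableTopology Ω] [BorelSpace Ω]

lemma trunc_bound (G : Ω → Ω → ℝ≥0∞) (κ q : ℝ) (hq0 : 0 < q) (hq1 : q < 1)
    (μ σ : Measure Ω) [SFinite μ] [SFinite σ]
    (hG : IsQuasiMetricKernel G κ) (u : Ω → ℝ≥0∞) (L : Measure Ω)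
    (hL : L = σ.withDensity (fun y => u y ^ q) + μ)
    (hu : ∀ᵐ y ∂σ, u y ≤ pot G L y) (y₀ : Ω) (hy₀ : pot G L y₀ ≠ ∞) (x : Ω)
    {ε : ℝ} (hε : 0 < ε) :
    ∫⁻ r in Set.Ioi ε, L (ball G x r) / ENNReal.ofReal (r ^ 2) ≤
      ENNReal.ofReal ((8 * κ) ^ (q / (1 - q))) *
        (pot G σ x ^ ((1 : ℝ) / (1 - q)) + kpot G q σ x + pot G μ x) := by
  obtain ⟨hK, hκ, hpos, hsymm, htri⟩ := hG
  have : SFinite L := by rw [hL]; infer_instance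
  have hκ0 : 0 < κ := by linarith
  have hfin : ∀ x y, (G x y)⁻¹ ≠ ∞ := fun x y => by simpa using (hpos x y).ne'
  have hεE : ENNReal.ofReal ε ≠ 0 := by simpa using hε
  set T := ∫⁻ r in Set.Ioi ε, L (ball G x r) / ENNReal.ofReal (r ^ 2) with hTdef
  have hT1 : T = ∫⁻ z, (max (G x z)⁻¹ (ENNReal.ofReal ε))⁻¹ ∂L := by
    have := layer hK hpos L x one_pos hε.le
    simpa using this
  have hmm : Measurable fun z => (max (G x z)⁻¹ (ENNReal.ofReal ε))⁻¹ :=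
    ((meas_Gx hK x).inv.max measurable_const).inv
  -- finiteness
  have hTfin : T ≠ ∞ := by
    set k : ℝ≥0∞ := ENNReal.ofReal κ * ((G x y₀)⁻¹ / ENNReal.ofReal ε + 1) with hk
    have hk0 : k ≠ 0 := by simp [hk, hκ0]
    have hk1 : k ≠ ∞ := by
      refine ENNReal.mul_ne_top ENNReal.ofReal_ne_top (ENNReal.add_ne_top.2 ⟨?_, by simp⟩)
      exact ENNReal.div_ne_top (hfin _ _) hεE
    have hle : T ≤ k * pot G L y₀ := by
      rw [hT1, pot, ← lintegral_const_mul _ (meas_Gx hK y₀)]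
      refine lintegral_mono fun z => ?_
      rw [← inv_inv (G y₀ z)]
      refine inv_le_mul_inv' hk0 hk1 ?_
      calc (G y₀ z)⁻¹ ≤ ENNReal.ofReal κ * ((G y₀ x)⁻¹ + (G x z)⁻¹) := htri _ _ _
        _ ≤ ENNReal.ofReal κ * ((G x y₀)⁻¹ / ENNReal.ofReal ε * ENNReal.ofReal ε
              + (G x z)⁻¹) := by
            rw [ENNReal.div_mul_cancel hεE ENNReal.ofReal_ne_top, hsymm y₀ x]
        _ ≤ ENNReal.ofReal κ * ((G x y₀)⁻¹ / ENNReal.ofReal ε *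
              (max (G x z)⁻¹ (ENNReal.ofReal ε)) + max (G x z)⁻¹ (ENNReal.ofReal ε)) := by
            gcongr
            · exact le_max_right _ _
            · exact le_max_left _ _
        _ = _ := by rw [hk]; ring
    exact ne_top_of_le_ne_top (ENNReal.mul_ne_top hk1 hy₀) hle
  have hballfin : ∀ R, ε < R → L (ball G x R) ≠ ∞ := by
    intro R hR
    have hR0 : 0 < R := hε.trans hR
    have hRE : ENNReal.ofReal R ≠ 0 := by simpa using hR0
    have : (ENNReal.ofReal R)⁻¹ * L (ball G x R) ≤ T := by
      rw [hT1, ← lintegral_indicator_const (meas_ball hK x R)]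
      refine lintegral_mono fun z => ?_
      classical
      rw [Set.indicator_apply]
      split_ifs with hz
      swap
      · exact bot_le
      rw [ENNReal.inv_le_inv]
      exact max_le (le_of_lt hz) (ENNReal.ofReal_le_ofReal hR.le)
    intro hc
    rw [hc, ENNReal.mul_top (by simp)] at this
    exact hTfin (top_le_iff.1 this)
  -- far part
  have h2κ : (1 : ℝ) ≤ 2 * κ := by linarith
  have hk0 : ENNReal.ofReal (2 * κ) ≠ 0 := by simpa using hκ0
  have hk1 : ENNReal.ofReal (2 * κ) ≠ ∞ := ENNReal.ofReal_ne_top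
  have hfar : ∀ r, ε < r → ∀ y ∈ ball G x r,
      ∫⁻ z in (ball G x (2 * κ * r))ᶜ, G y z ∂L ≤ ENNReal.ofReal (2 * κ) * T := by
    intro r hr y hy
    have hr0 : 0 < r := hε.trans hr
    rw [hT1, ← lintegral_const_mul _ hmm]
    refine le_trans (setLIntegral_mono' (meas_ball hK x _).compl fun z hz => ?_)
      (setLIntegral_le_lintegral _ _)
    have hz' : ENNReal.ofReal (2 * κ * r) ≤ (G x z)⁻¹ := not_lt.1 hz
    have hy' : (G x y)⁻¹ < ENNReal.ofReal r := hy
    have hrr : r ≤ 2 * κ * r := by nlinarith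
    have hmax : max (G x z)⁻¹ (ENNReal.ofReal ε) = (G x z)⁻¹ :=
      max_eq_left ((ENNReal.ofReal_le_ofReal (by linarith)).trans hz')
    rw [hmax]
    conv_lhs => rw [← inv_inv (G y z)]
    refine inv_le_mul_inv' hk0 hk1 ?_
    have ht := htri x z y
    have ha := hfin x y
    have hb := hfin y z
    have hc := hfin x z
    generalize (G x y)⁻¹ = a at *
    generalize (G y z)⁻¹ = b at *
    generalize (G x z)⁻¹ = c at *
    lift a to NNReal using ha
    lift b to NNReal using hb
    lift c to NNReal using hc
    rw [← ENNReal.ofReal_coe_nnreal (p := c), ← ENNReal.ofReal_coe_nnreal (p := b),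
      ← ENNReal.ofReal_mul (by linarith), ENNReal.ofReal_le_ofReal_iff (by positivity)]
    rw [← ENNReal.ofReal_coe_nnreal (p := a), ENNReal.ofReal_lt_ofReal_iff hr0] at hy'
    rw [← ENNReal.ofReal_coe_nnreal (p := c), ENNReal.ofReal_le_ofReal_iff c.coe_nonneg] at hz'
    rw [← ENNReal.ofReal_coe_nnreal (p := c), ← ENNReal.ofReal_coe_nnreal (p := b),
      ← ENNReal.ofReal_coe_nnreal (p := a), ← ENNReal.ofReal_add a.coe_nonneg b.coe_nonneg,
      ← ENNReal.ofReal_mul hκ0.le, ENNReal.ofReal_le_ofReal_iff (by positivity)] at ht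
    nlinarith
  set kap : ℝ → ℝ≥0∞ := fun r => kappa G q (σ.restrict (ball G x r)) with hkap
  -- the local estimate
  have hloc : ∀ r, ε < r → ∫⁻ y in ball G x r, u y ^ q ∂σ ≤
      kap r ^ q * L (ball G x (2 * κ * r)) ^ q
        + (ENNReal.ofReal (2 * κ) * T) ^ q * σ (ball G x r) := by
    intro r hr
    have hr0 : 0 < r := hε.trans hr
    have hrr : r ≤ 2 * κ * r := by nlinarith
    have hf : IsFiniteMeasure (L.restrict (ball G x (2 * κ * r))) :=
      ⟨by rw [Measure.restrict_apply_univ]; exact (hballfin _ (by linarith)).lt_top⟩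
    have hs := kappa_spec G hq0 (σ.restrict (ball G x r)) (L.restrict (ball G x (2 * κ * r)))
    rw [Measure.restrict_apply_univ] at hs
    calc ∫⁻ y in ball G x r, u y ^ q ∂σ ≤ ∫⁻ y in ball G x r,
          (pot G (L.restrict (ball G x (2 * κ * r))) y ^ q
            + (ENNReal.ofReal (2 * κ) * T) ^ q) ∂σ := by
          refine lintegral_mono_ae ?_
          filter_upwards [ae_restrict_of_ae hu, ae_restrict_mem (meas_ball hK x r)] with y h1 h2
          refine le_trans (ENNReal.rpow_le_rpow (h1.trans ?_) hq0.le)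
            (ENNReal.rpow_add_le_add_rpow _ _ hq0.le hq1.le)
          rw [pot, ← lintegral_add_compl _ (meas_ball hK x (2 * κ * r))]
          exact add_le_add le_rfl (hfar r hr y h2)
      _ = _ := by
          rw [lintegral_add_right _ measurable_const, lintegral_const,
            Measure.restrict_apply_univ]
      _ ≤ _ := by gcongr
  have hinv : Measurable fun r : ℝ => (ENNReal.ofReal (r ^ 2))⁻¹ := by fun_prop
  have hmeask : Measurable fun r => kap r ^ (q / (1 - q)) / ENNReal.ofReal (r ^ 2) := by
    have : Monotone kap := fun a b h =>
      kappa_mono G hq0 (Measure.restrict_mono_set _ (ball_mono G x h))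
    simp only [div_eq_mul_inv]
    exact (this.measurable.pow_const _).mul hinv
  have hmeasL : ∀ (ν : Measure Ω) (c : ℝ), 0 ≤ c →
      Measurable fun r => ν (ball G x (c * r)) / ENNReal.ofReal (r ^ 2) := by
    intro ν c hc
    have : Monotone fun r => ν (ball G x (c * r)) := fun a b h =>
      measure_mono (ball_mono G x (mul_le_mul_of_nonneg_left h hc))
    simp only [div_eq_mul_inv]
    exact this.measurable.mul hinv
  -- scaling
  have hscale : ∫⁻ r in Set.Ioi ε, L (ball G x (2 * κ * r)) / ENNReal.ofReal (r ^ 2) ≤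
      ENNReal.ofReal (2 * κ) * T := by
    rw [layer hK hpos L x (by linarith : 0 < 2 * κ) hε.le, hT1,
      ← lintegral_const_mul _ hmm]
    refine lintegral_mono fun z => inv_le_mul_inv' hk0 hk1 (max_le ?_ ?_)
    · calc (G x z)⁻¹ = ENNReal.ofReal (2 * κ) * ((G x z)⁻¹ / ENNReal.ofReal (2 * κ)) := by
            rw [ENNReal.mul_div_cancel hk0 hk1]
        _ ≤ _ := by gcongr; exact le_max_left _ _
    · calc ENNReal.ofReal ε = 1 * ENNReal.ofReal ε := (one_mul _).symm
        _ ≤ _ := by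
          gcongr
          · rw [← ENNReal.ofReal_one]; exact ENNReal.ofReal_le_ofReal h2κ
          · exact le_max_right _ _
  have hq : 0 < 1 - q := by linarith
  -- Hölder
  have hhold : ∫⁻ r in Set.Ioi ε,
      kap r ^ q * L (ball G x (2 * κ * r)) ^ q / ENNReal.ofReal (r ^ 2) ≤
      kpot G q σ x ^ (1 - q) * (ENNReal.ofReal (2 * κ) * T) ^ q := by
    have h := ENNReal.lintegral_mul_norm_pow_le (μ := volume.restrict (Set.Ioi ε))
      hmeask.aemeasurable (hmeasL L (2 * κ) (by linarith)).aemeasurable hq.le hq0.le (by ring)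
    refine le_trans (le_of_eq ?_) (h.trans ?_)
    · refine lintegral_congr fun r => ?_
      simp only [div_eq_mul_inv]
      rw [ENNReal.mul_rpow_of_nonneg _ _ hq.le, ENNReal.mul_rpow_of_nonneg _ _ hq0.le,
        ← ENNReal.rpow_mul, inv_mul_cancel_right₀ hq.ne' q]
      have e : ((ENNReal.ofReal (r ^ 2))⁻¹) ^ (1 - q) * ((ENNReal.ofReal (r ^ 2))⁻¹) ^ q
          = (ENNReal.ofReal (r ^ 2))⁻¹ := by
        rw [← ENNReal.rpow_add_of_nonneg _ _ hq.le hq0.le]; simp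
      conv_lhs => rw [← e]
      ring
    · refine mul_le_mul' (ENNReal.rpow_le_rpow ?_ hq.le) (ENNReal.rpow_le_rpow hscale hq0.le)
      exact lintegral_mono_set (Set.Ioi_subset_Ioi hε.le)
  have hsub : ∀ ν : Measure Ω, SFinite ν →
      ∫⁻ r in Set.Ioi ε, ν (ball G x r) / ENNReal.ofReal (r ^ 2) ≤ pot G ν x := by
    intro ν _
    rw [← layer0 hK hpos ν x]
    exact lintegral_mono_set (Set.Ioi_subset_Ioi hε.le)
  refine algebra_step hq0 hq1 hκ hTfin ?_
  have hTle : T ≤ ∫⁻ r in Set.Ioi ε,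
      (kap r ^ q * L (ball G x (2 * κ * r)) ^ q / ENNReal.ofReal (r ^ 2)
       + (ENNReal.ofReal (2 * κ) * T) ^ q * (σ (ball G x r) / ENNReal.ofReal (r ^ 2))
       + μ (ball G x r) / ENNReal.ofReal (r ^ 2)) := by
    refine setLIntegral_mono' measurableSet_Ioi fun r hr => ?_
    have : L (ball G x r) = ∫⁻ y in ball G x r, u y ^ q ∂σ + μ (ball G x r) := by
      rw [hL, Measure.add_apply, withDensity_apply _ (meas_ball hK x r)]
    rw [this, ENNReal.add_div]
    refine add_le_add ?_ le_rfl
    rw [← mul_div_assoc, ← ENNReal.add_div]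
    exact ENNReal.div_le_div_right (hloc r hr) _
  have m1 : Measurable fun r => μ (ball G x r) / ENNReal.ofReal (r ^ 2) := by
    simpa using hmeasL μ 1 zero_le_one
  have m2 : Measurable fun r => σ (ball G x r) / ENNReal.ofReal (r ^ 2) := by
    simpa using hmeasL σ 1 zero_le_one
  rw [lintegral_add_right _ m1, lintegral_add_right _ (m2.const_mul _),
    lintegral_const_mul _ m2] at hTle
  refine hTle.trans ?_
  rw [mul_add, mul_comm _ (kpot G q σ x ^ (1 - q))]
  gcongr
  · exact hsub σ inferInstance
  · exact hsub μ inferInstance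

lemma full_bound (G : Ω → Ω → ℝ≥0∞) (κ q : ℝ) (hq0 : 0 < q) (hq1 : q < 1)
    (μ σ : Measure Ω) [SFinite μ] [SFinite σ]
    (hG : IsQuasiMetricKernel G κ) (u : Ω → ℝ≥0∞) (L : Measure Ω)
    (hL : L = σ.withDensity (fun y => u y ^ q) + μ)
    (hu : ∀ᵐ y ∂σ, u y ≤ pot G L y) (hfin : ∀ᵐ y ∂σ, pot G L y < ∞) (x : Ω) :
    pot G L x ≤
      ENNReal.ofReal ((8 * κ) ^ (q / (1 - q))) *
        (pot G σ x ^ ((1 : ℝ) / (1 - q)) + kpot G q σ x + pot G μ x) := by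
  by_cases hσ : σ = 0
  · have h8 : (1 : ℝ≥0∞) ≤ ENNReal.ofReal ((8 * κ) ^ (q / (1 - q))) := by
      rw [← ENNReal.ofReal_one]
      refine ENNReal.ofReal_le_ofReal (Real.one_le_rpow (by linarith [hG.2.1]) ?_)
      exact div_nonneg hq0.le (by linarith)
    have : L = μ := by rw [hL, hσ]; simp
    rw [this]
    calc pot G μ x = 1 * pot G μ x := (one_mul _).symm
      _ ≤ _ := mul_le_mul' h8 le_add_self
  have : (ae σ).NeBot := ae_neBot.2 hσ
  obtain ⟨y₀, hy₀⟩ := hfin.exists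
  have : SFinite L := by rw [hL]; infer_instance
  rw [← layer0 hG.1 hG.2.2.1 L x]
  have hU : Set.Ioi (0 : ℝ) = ⋃ n : ℕ, Set.Ioi (1 / ((n : ℝ) + 1)) := by
    ext r
    simp only [Set.mem_Ioi, Set.mem_iUnion]
    exact ⟨fun h => exists_nat_one_div_lt h, fun ⟨n, hn⟩ => lt_trans (by positivity) hn⟩
  rw [hU, setLIntegral_iUnion_of_directed]
  · exact iSup_le fun n => trunc_bound G κ q hq0 hq1 μ σ hG u L hL hu y₀ hy₀.ne x (by positivity)
  · refine Monotone.directed_le (fun m n h => Set.Ioi_subset_Ioi ?_)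
    exact one_div_le_one_div_of_le (by positivity) (by simpa using h)

end top


/-- upper bound
`u ≤ (8κ)^{q/(1-q)} [(Gσ)^{1/(1-q)} + Kσ + Gμ]` for sub-solutions, for quasi-metric
kernels. -/
theorem statement14 [LocallyCompactSpace Ω] [T2Space Ω] [SecondCountableTopology Ω]
    [BorelSpace Ω] (G : Ω → Ω → ℝ≥0∞) (κ q : ℝ) (hq0 : 0 < q) (hq1 : q < 1)
    (μ σ : Measure Ω) [IsLocallyFiniteMeasure μ] [IsLocallyFiniteMeasure σ]
    (hG : IsQuasiMetricKernel G κ)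
    (u : Ω → ℝ≥0∞) (hsub : IsSubSol G σ q (pot G μ) u) :
    (∀ x : Ω, u x ≤ potF G σ (fun y => u y ^ q) x + pot G μ x →
      u x ≤ ENNReal.ofReal ((8 * κ) ^ (q / (1 - q))) *
        (pot G σ x ^ ((1 : ℝ) / (1 - q)) + kpot G q σ x + pot G μ x)) ∧
    ∀ᵐ x ∂σ, u x ≤ ENNReal.ofReal ((8 * κ) ^ (q / (1 - q))) *
        (pot G σ x ^ ((1 : ℝ) / (1 - q)) + kpot G q σ x + pot G μ x) := by
  obtain ⟨hm, hae⟩ := hsub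
  have hpot : ∀ y, pot G (σ.withDensity (fun y => u y ^ q) + μ) y
      = potF G σ (fun y => u y ^ q) y + pot G μ y := by
    intro y
    rw [pot, lintegral_add_measure, lintegral_withDensity_eq_lintegral_mul _ (hm.pow_const q)
      (meas_Gx hG.1 y)]
    simp only [pot, potF, Pi.mul_apply, mul_comm]
  have key := full_bound G κ q hq0 hq1 μ σ hG u _ rfl
    (hae.mono fun y hy => by rw [hpot]; exact hy.1)
    (hae.mono fun y hy => by rw [hpot]; exact hy.2)
  have h1 : ∀ x : Ω, u x ≤ potF G σ (fun y => u y ^ q) x + pot G μ x →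
      u x ≤ ENNReal.ofReal ((8 * κ) ^ (q / (1 - q))) *
        (pot G σ x ^ ((1 : ℝ) / (1 - q)) + kpot G q σ x + pot G μ x) := fun x hx => by
    rw [← hpot] at hx
    exact hx.trans (key x)
  exact ⟨h1, hae.mono fun x hx => h1 x hx.1⟩


end NPE
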